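/- Let p be a prime and q a power of a prime different from p. Fix an algebraic closure Ω of the field 𝔽_q with q elements and let K := {x ∈ Ω : x^{q^{p^n}} = x for some n ≥ 0}, the union inside Ω of the finite fields with q^{p^n} elements (the cyclotomic ℤ_p-extension of 𝔽_q). Then the p-primary torsion subgroup of the multiplicative group K^× equals the group of all p-power roots of unity of Ω and is isomorphic to ℚ_p/ℤ_p (in particular it is divisible of corank 1) if p divides q − 1, and it is trivial if p does not divide q − 1. -/

import Mathlib

/-- The Prüfer group `ℚ_p/ℤ_p`, realized as the quotient of `ℚ_p` by `ℤ_p`. -/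
noncomputable abbrev PruferModule (p : ℕ) [Fact p.Prime] :=
  ℚ_[p] ⧸ LinearMap.range (Algebra.linearMap ℤ_[p] ℚ_[p])

/-- A homomorphism from a `p`-primary abelian group that is injective on `p`-torsion is
injective. -/
theorem AddMonoidHom.injective_of_injOn_prime_torsion {A B : Type*} [AddCommGroup A]
    [AddCommGroup B] {p : ℕ} (f : A →+ B) (hA : ∀ a : A, ∃ n : ℕ, p ^ n • a = 0)
    (hf : ∀ a : A, p • a = 0 → f a = 0 → a = 0) : Function.Injective f := by
  rw [injective_iff_map_eq_zero]
  intro a ha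
  obtain ⟨n, hn⟩ := hA a
  induction n generalizing a with
  | zero => simpa using hn
  | succ n ih =>
    refine hf a (ih (p • a) (by simp [ha]) ?_) ha
    rw [smul_smul, ← pow_succ, hn]

/-- A homomorphism from a `p`-divisible abelian group whose range contains the `p`-torsion
has range containing the whole `p`-primary torsion. -/
theorem AddMonoidHom.mem_range_of_prime_torsion_mem_range {A B : Type*} [AddCommGroup A]
    [AddCommGroup B] {p : ℕ} (f : A →+ B) (hA : ∀ a : A, ∃ a' : A, p • a' = a)
    (hf : ∀ b : B, p • b = 0 → b ∈ f.range) (n : ℕ) (b : B) (hb : p ^ n • b = 0) :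
    b ∈ f.range := by
  induction n generalizing b with
  | zero =>
    rw [pow_zero, one_smul] at hb
    exact hb ▸ f.range.zero_mem
  | succ n ih =>
    obtain ⟨a, ha⟩ := ih (p • b) (by rw [smul_smul, ← pow_succ, hb])
    obtain ⟨a', rfl⟩ := hA a
    have h := hf (b - f a') (by rw [smul_sub, ← ha, map_nsmul, sub_self])
    simpa using f.range.add_mem h ⟨a', rfl⟩

namespace PruferModule

variable {p : ℕ} [Fact p.Prime]

theorem mk_eq_zero_iff {x : ℚ_[p]} :
    (Submodule.Quotient.mk x : PruferModule p) = 0 ↔ ‖x‖ ≤ 1 := by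
  rw [Submodule.Quotient.mk_eq_zero]
  constructor
  · rintro ⟨y, rfl⟩
    exact y.2
  · intro h
    exact ⟨⟨x, h⟩, rfl⟩

theorem exists_pow_smul_eq_zero (a : PruferModule p) : ∃ n : ℕ, p ^ n • a = 0 := by
  induction a using Submodule.Quotient.induction_on with | H x => ?_
  have hp : (1 : ℝ) < p := mod_cast (Fact.out : p.Prime).one_lt
  obtain ⟨n, hn⟩ := pow_unbounded_of_one_lt ‖x‖ hp
  refine ⟨n, ?_⟩
  rw [← Submodule.Quotient.mk_smul, mk_eq_zero_iff, nsmul_eq_mul, norm_mul, Nat.cast_pow,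
    norm_pow, Padic.norm_p, inv_pow]
  exact inv_mul_le_one_of_le₀ hn.le (by positivity)

theorem exists_smul_eq (a : PruferModule p) : ∃ b : PruferModule p, p • b = a := by
  induction a using Submodule.Quotient.induction_on with | H x => ?_
  have hp : (p : ℚ_[p]) ≠ 0 := mod_cast (Fact.out : p.Prime).ne_zero
  refine ⟨Submodule.Quotient.mk (x / p), ?_⟩
  rw [← Submodule.Quotient.mk_smul, nsmul_eq_mul, mul_div_cancel₀ _ hp]

/-- The class of `1 / p`, a generator of the `p`-torsion. -/
noncomputable def invP (p : ℕ) [Fact p.Prime] : PruferModule p :=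
  Submodule.Quotient.mk (p : ℚ_[p])⁻¹

theorem zsmul_invP_eq_zero_iff {j : ℤ} : j • invP p = 0 ↔ (p : ℤ) ∣ j := by
  have hp : (0 : ℝ) < p := mod_cast (Fact.out : p.Prime).pos
  rw [invP, ← Submodule.Quotient.mk_smul, mk_eq_zero_iff, zsmul_eq_mul, norm_mul, norm_inv,
    Padic.norm_p, inv_inv, ← le_div_iff₀ hp, one_div]
  have := Padic.norm_int_le_pow_iff_dvd (p := p) j 1
  simpa using this

theorem exists_zsmul_invP_eq {a : PruferModule p} (ha : p • a = 0) : ∃ j : ℤ, j • invP p = a := by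
  induction a using Submodule.Quotient.induction_on with | H x => ?_
  have hp : (p : ℚ_[p]) ≠ 0 := mod_cast (Fact.out : p.Prime).ne_zero
  rw [← Submodule.Quotient.mk_smul, mk_eq_zero_iff, nsmul_eq_mul] at ha
  obtain ⟨y, hy⟩ : ∃ y : ℤ_[p], (y : ℚ_[p]) = p * x := ⟨⟨p * x, ha⟩, rfl⟩
  obtain ⟨j, -, hj⟩ := PadicInt.exists_mem_range y
  rw [PadicInt.maximalIdeal_eq_span_p, Ideal.mem_span_singleton] at hj
  obtain ⟨c, hc⟩ := hj
  refine ⟨j, ?_⟩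
  rw [← sub_eq_zero, invP, ← Submodule.Quotient.mk_smul, ← Submodule.Quotient.mk_sub,
    mk_eq_zero_iff]
  have h : (p : ℚ_[p]) * x - j = p * c := by
    simpa [hy] using congrArg (fun z : ℤ_[p] => (z : ℚ_[p])) hc
  have h' : (j : ℤ) • (p : ℚ_[p])⁻¹ - x = -c := by
    rw [zsmul_eq_mul, Int.cast_natCast]
    field_simp
    linear_combination -h
  rw [h', norm_neg]
  exact c.2

end PruferModule

/-- In an algebraically closed field in which `p ≠ 0`, the group of `p`-power roots of unity is
isomorphic to `ℚ_p/ℤ_p`. -/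
theorem PruferModule.exists_injective_range_eq (p : ℕ) [Fact p.Prime] (Ω : Type*) [Field Ω]
    [IsAlgClosed Ω] [NeZero (p : Ω)] :
    ∃ f : Multiplicative (PruferModule p) →* Ωˣ, Function.Injective f ∧
      ∀ u : Ωˣ, u ∈ f.range ↔ ∃ n : ℕ, u ^ p ^ n = 1 := by
  have hp : p.Prime := Fact.out
  obtain ⟨ζ, hζ⟩ := HasEnoughRootsOfUnity.exists_primitiveRoot Ω p
  obtain ⟨ζ, rfl⟩ := hζ.isUnit hp.ne_zero
  replace hζ : IsPrimitiveRoot ζ p := IsPrimitiveRoot.coe_units_iff.1 hζ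
  have hroot {n : ℕ} (hn : n ≠ 0) : Function.Surjective (n • · : Additive Ωˣ → Additive Ωˣ) := by
    intro a
    obtain ⟨z, hz⟩ := IsAlgClosed.exists_pow_nat_eq (a.toMul : Ω) (Nat.pos_of_ne_zero hn)
    have hz0 : z ≠ 0 := by
      rintro rfl
      rw [zero_pow hn] at hz
      exact a.toMul.ne_zero hz.symm
    exact ⟨Additive.ofMul (Units.mk0 z hz0), congrArg Additive.ofMul (Units.ext hz)⟩
  let _ : DivisibleBy (Additive Ωˣ) ℕ := divisibleByOfSMulRightSurj _ _ hroot
  let _ : DivisibleBy (Additive Ωˣ) ℤ := AddGroup.divisibleByIntOfDivisibleByNat _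
  let i : ZMod p →+ PruferModule p :=
    ZMod.lift p ⟨zmultiplesHom _ (invP p), by simpa using zsmul_invP_eq_zero_iff.2 dvd_rfl⟩
  let g : ZMod p →+ Additive Ωˣ :=
    ZMod.lift p ⟨zmultiplesHom _ (Additive.ofMul ζ), by
      simpa using congrArg Additive.ofMul hζ.pow_eq_one⟩
  have hi : Function.Injective i := by
    rw [ZMod.lift_injective]
    intro j hj
    rw [ZMod.intCast_zmod_eq_zero_iff_dvd]
    exact zsmul_invP_eq_zero_iff.1 (by simpa using hj)
  obtain ⟨f, hf⟩ := Module.Baer.extension_property (Module.Baer.of_divisible (Additive Ωˣ))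
    i.toIntLinearMap hi g.toIntLinearMap
  have hfP : f (invP p) = Additive.ofMul ζ := by
    have h := DFunLike.congr_fun hf (1 : ZMod p)
    have h1 : i 1 = invP p := by
      simpa using ZMod.lift_coe p ⟨zmultiplesHom _ (invP p), by
        simpa using zsmul_invP_eq_zero_iff.2 dvd_rfl⟩ 1
    have h2 : g 1 = Additive.ofMul ζ := by
      simpa using ZMod.lift_coe p ⟨zmultiplesHom _ (Additive.ofMul ζ), by
        simpa using congrArg Additive.ofMul hζ.pow_eq_one⟩ 1
    rw [← h1, ← h2]
    exact h
  have hinj := f.toAddMonoidHom.injective_of_injOn_prime_torsion exists_pow_smul_eq_zero <| by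
    intro a ha hfa
    obtain ⟨j, rfl⟩ := exists_zsmul_invP_eq ha
    rw [zsmul_invP_eq_zero_iff, ← hζ.zpow_eq_one_iff_dvd]
    rw [map_zsmul] at hfa
    change j • f (invP p) = 0 at hfa
    rw [hfP] at hfa
    exact congrArg Additive.toMul hfa
  refine ⟨f.toAddMonoidHom.toMultiplicativeLeft, hinj, fun u => ⟨?_, ?_⟩⟩
  · rintro ⟨a, rfl⟩
    obtain ⟨n, hn⟩ := exists_pow_smul_eq_zero a.toAdd
    refine ⟨n, ?_⟩
    have h : a ^ p ^ n = 1 := congrArg Multiplicative.ofAdd hn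
    rw [← map_pow, h, map_one]
  · rintro ⟨n, hn⟩
    obtain ⟨a, ha⟩ := f.toAddMonoidHom.mem_range_of_prime_torsion_mem_range exists_smul_eq
      (p := p) (by
        intro b hb
        have : NeZero p := ⟨hp.ne_zero⟩
        obtain ⟨j, -, hj⟩ := (IsPrimitiveRoot.coe_units_iff.2 hζ).eq_pow_of_pow_eq_one
          (ξ := (b.toMul : Ω)) (congrArg (fun v : Additive Ωˣ => (v.toMul : Ω)) hb)
        refine ⟨j • invP p, ?_⟩
        rw [map_nsmul]
        change j • f (invP p) = b
        rw [hfP]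
        exact congrArg Additive.ofMul (Units.ext ((Units.val_pow_eq_pow_val _ _).trans hj)))
      n (Additive.ofMul u) (congrArg Additive.ofMul hn)
    exact ⟨Multiplicative.ofAdd a, congrArg Additive.toMul ha⟩

theorem Nat.pow_dvd_pow_prime_pow_sub_one {p q : ℕ} (hq : 0 < q) (h : p ∣ q - 1) (n : ℕ) :
    p ^ n ∣ q ^ p ^ n - 1 := by
  have h1 : (p : ℤ) ∣ (q : ℤ) - 1 := by
    have := Int.natCast_dvd_natCast.2 h
    rwa [Nat.cast_sub hq, Nat.cast_one] at this
  have h2 := dvd_sub_pow_of_dvd_sub h1 n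
  rw [one_pow] at h2
  rw [← Int.natCast_dvd_natCast, Nat.cast_sub (Nat.pow_pos hq)]
  push_cast
  exact (pow_dvd_pow _ n.le_succ).trans h2

theorem Nat.coprime_pow_prime_pow_sub_one {p q : ℕ} [Fact p.Prime] (hq : 0 < q)
    (h : ¬ p ∣ q - 1) (n : ℕ) : p.Coprime (q ^ p ^ n - 1) := by
  rw [Nat.Prime.coprime_iff_not_dvd Fact.out]
  rw [← CharP.cast_eq_zero_iff (ZMod p)] at h ⊢
  rw [Nat.cast_sub hq] at h
  rw [Nat.cast_sub (Nat.pow_pos hq)]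
  simpa [ZMod.pow_card_pow] using h

/-- Let `p` be a prime, `q` a power of a prime different from `p`,
`Ω` an algebraic closure of the field `F` with `q` elements, and
`K = {x ∈ Ω | x^(q^(p^n)) = x for some n}` the cyclotomic `ℤ_p`-extension of `F`
inside `Ω`.  Then the `p`-primary torsion subgroup `T` of `K^×` equals the group of
all `p`-power roots of unity of `Ω` and is isomorphic to `ℚ_p/ℤ_p` if `p ∣ q - 1`,
and is trivial if `p ∤ q - 1`. -/
theorem p_primary_torsion_of_cyclotomic_Zp_extension_of_finite_field
    (p q : ℕ) [Fact p.Prime]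
    (hq : ∃ ℓ m : ℕ, ℓ.Prime ∧ ℓ ≠ p ∧ 0 < m ∧ q = ℓ ^ m)
    (F : Type) [Field F] [Fintype F] (hF : Fintype.card F = q)
    (Ω : Type) [Field Ω] [Algebra F Ω] [IsAlgClosure F Ω]
    (K : Subfield Ω)
    (hK : ∀ x : Ω, x ∈ K ↔ ∃ n : ℕ, x ^ q ^ p ^ n = x)
    (T : Subgroup Kˣ)
    (hT : ∀ u : Kˣ, u ∈ T ↔ ∃ n : ℕ, u ^ p ^ n = 1) :
    (p ∣ q - 1 →
      ((fun u : Kˣ => ((u : K) : Ω)) '' (T : Set Kˣ) = {y : Ω | ∃ n : ℕ, y ^ p ^ n = 1}) ∧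
      Nonempty (T ≃* Multiplicative (PruferModule p))) ∧
    (¬ p ∣ q - 1 → T = ⊥) := by
  have hp : p.Prime := Fact.out
  have : IsAlgClosed Ω := IsAlgClosure.isAlgClosed F
  have hq0 : 0 < q := hF ▸ Fintype.card_pos
  have : NeZero (p : Ω) := by
    obtain ⟨ℓ, m, hℓ, hne, -, rfl⟩ := hq
    refine ⟨fun h => ?_⟩
    have hcop : IsCoprime (p : ℤ) ((ℓ ^ m : ℕ) : ℤ) :=
      Nat.isCoprime_iff_coprime.2 (((Nat.coprime_primes hp hℓ).2 hne.symm).pow_right m)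
    obtain ⟨a, b, hab⟩ := hcop
    have hq : ((ℓ ^ m : ℕ) : Ω) = 0 := by
      rw [← hF, ← map_natCast (algebraMap F Ω), Nat.cast_card_eq_zero, map_zero]
    have := congrArg (Int.cast : ℤ → Ω) hab
    rw [Int.cast_add, Int.cast_mul, Int.cast_mul, Int.cast_natCast, Int.cast_natCast, h, hq] at this
    simp at this
  refine ⟨fun hdvd => ?_, fun hndvd => ?_⟩
  · have himage : (fun u : Kˣ => ((u : K) : Ω)) '' (T : Set Kˣ) =
        {y : Ω | ∃ n : ℕ, y ^ p ^ n = 1} := by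
      ext y
      constructor
      · rintro ⟨u, hu, rfl⟩
        obtain ⟨n, hn⟩ := (hT u).1 hu
        exact ⟨n, by simpa using congrArg (fun v : Kˣ => ((v : K) : Ω)) hn⟩
      · rintro ⟨n, hn⟩
        have hy0 : y ≠ 0 := by
          rintro rfl
          rw [zero_pow (pow_ne_zero _ hp.ne_zero)] at hn
          exact zero_ne_one hn
        have hyK : y ∈ K := by
          refine (hK y).2 ⟨n, ?_⟩
          obtain ⟨c, hc⟩ := Nat.pow_dvd_pow_prime_pow_sub_one hq0 hdvd n
          rw [← Nat.sub_add_cancel (Nat.one_le_pow (p ^ n) q hq0), hc, pow_succ, pow_mul, hn,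
            one_pow, one_mul]
        refine ⟨Units.mk0 (⟨y, hyK⟩ : K) fun h => hy0 (congrArg Subtype.val h), ?_, rfl⟩
        exact (hT _).2 ⟨n, Units.ext (Subtype.ext hn)⟩
    refine ⟨himage, ?_⟩
    obtain ⟨f, hf, hrange⟩ := PruferModule.exists_injective_range_eq p Ω
    let g : T →* Ωˣ := (Units.map (K.subtype : K →* Ω)).comp T.subtype
    have hg : Function.Injective g :=
      (Units.map_injective K.subtype.injective).comp T.subtype_injective
    have hfg : g.range = f.range := by
      ext u
      rw [hrange]
      have h := Set.ext_iff.1 himage (u : Ω)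
      constructor
      · rintro ⟨t, rfl⟩
        obtain ⟨n, hn⟩ := h.1 ⟨t, t.2, rfl⟩
        exact ⟨n, Units.ext hn⟩
      · rintro ⟨n, hn⟩
        obtain ⟨t, ht, htu⟩ := h.2 ⟨n, congrArg Units.val hn⟩
        exact ⟨⟨t, ht⟩, Units.ext htu⟩
    exact ⟨(MonoidHom.ofInjective hg).trans
      ((MulEquiv.subgroupCongr hfg).trans (MonoidHom.ofInjective hf).symm)⟩
  · rw [Subgroup.eq_bot_iff_forall]
    intro u hu
    obtain ⟨n, hn⟩ := (hT u).1 hu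
    obtain ⟨k, hk⟩ := (hK (u : K)).1 (u : K).2
    have hk' : u ^ (q ^ p ^ k - 1) = 1 := by
      have h : u ^ q ^ p ^ k = u := Units.ext (Subtype.ext (by simpa using hk))
      rw [← Nat.sub_add_cancel (Nat.one_le_pow (p ^ k) q hq0), pow_succ] at h
      exact mul_eq_right.1 h
    have hcop : (p ^ n).Coprime (q ^ p ^ k - 1) :=
      (Nat.coprime_pow_prime_pow_sub_one hq0 hndvd k).pow_left n
    have := pow_gcd_eq_one.2 ⟨hn, hk'⟩
    rwa [hcop.gcd_eq_one, pow_one] at this
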